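/- For every d ≥ 1, the probability that the three-way collision probability of a uniformly random state exceeds d^{−3/2} satisfies σ({ψ ∈ S : q_ψ ≥ d^{−3/2}}) ≤ 6/√d. -/

import Mathlib

open MeasureTheory

noncomputable section

/-- The unit sphere of `ℂ^d`. -/
abbrev unitSphere (d : ℕ) : Type := Metric.sphere (0 : EuclideanSpace ℂ (Fin d)) 1

/-- The action of a (complex-linear) isometric equivalence of `ℂ^d` on the unit sphere. -/
def sphereMap (d : ℕ) (U : EuclideanSpace ℂ (Fin d) ≃ₗᵢ[ℂ] EuclideanSpace ℂ (Fin d))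
    (ψ : unitSphere d) : unitSphere d :=
  ⟨U ψ.1, by
    have hψ : ‖(ψ : EuclideanSpace ℂ (Fin d))‖ = 1 := by
      simpa [mem_sphere_iff_norm] using ψ.2

    simp [mem_sphere_iff_norm, U.norm_map, hψ]⟩

instance (d : ℕ) : MeasurableSpace (EuclideanSpace ℂ (Fin d)) := borel _
instance (d : ℕ) : BorelSpace (EuclideanSpace ℂ (Fin d)) := ⟨rfl⟩

/-- `σ` is the rotation-invariant (uniform) probability measure on the unit sphere of `ℂ^d`. -/
def IsUniformSphereMeasure (d : ℕ) (σ : Measure (unitSphere d)) : Prop :=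
  IsProbabilityMeasure σ ∧
    ∀ U : EuclideanSpace ℂ (Fin d) ≃ₗᵢ[ℂ] EuclideanSpace ℂ (Fin d),
      σ.map (sphereMap d U) = σ

/-- The two-way collision probability `p_ψ = Σ_x |ψ_x|⁴`. -/
def pColl (d : ℕ) (ψ : unitSphere d) : ℝ :=
  ∑ x : Fin d, ‖(ψ : EuclideanSpace ℂ (Fin d)) x‖ ^ 4

/-- The three-way collision probability `q_ψ = Σ_x |ψ_x|⁶`. -/
def qColl (d : ℕ) (ψ : unitSphere d) : ℝ :=
  ∑ x : Fin d, ‖(ψ : EuclideanSpace ℂ (Fin d)) x‖ ^ 6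

@[fun_prop]
theorem continuous_sphereMap {d : ℕ}
    (U : EuclideanSpace ℂ (Fin d) ≃ₗᵢ[ℂ] EuclideanSpace ℂ (Fin d)) :
    Continuous (sphereMap d U) :=
  (U.continuous.comp continuous_subtype_val).subtype_mk _

/-- The integral of a continuous function against a uniform measure is unitarily invariant. -/
theorem IsUniformSphereMeasure.integral_sphereMap {d : ℕ} {σ : Measure (unitSphere d)}
    (hσ : IsUniformSphereMeasure d σ)
    (U : EuclideanSpace ℂ (Fin d) ≃ₗᵢ[ℂ] EuclideanSpace ℂ (Fin d))
    {f : unitSphere d → ℝ} (hf : Continuous f) :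
    ∫ ψ, f (sphereMap d U ψ) ∂σ = ∫ ψ, f ψ ∂σ := by
  conv_rhs => rw [← hσ.2 U]
  exact (integral_map (continuous_sphereMap U).aemeasurable hf.aestronglyMeasurable).symm

theorem IsUniformSphereMeasure.integrable {d : ℕ} {σ : Measure (unitSphere d)}
    (hσ : IsUniformSphereMeasure d σ) {f : unitSphere d → ℝ} (hf : Continuous f) :
    Integrable f σ := by
  have := hσ.1
  exact hf.integrable_of_hasCompactSupport (HasCompactSupport.of_compactSpace f)

/-- The squared modulus of the coordinate `x` of a state. -/
def coordProb {d : ℕ} (x : Fin d) (ψ : unitSphere d) : ℝ :=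
  ‖(ψ : EuclideanSpace ℂ (Fin d)) x‖ ^ 2

@[fun_prop]
theorem continuous_coordProb {d : ℕ} (x : Fin d) : Continuous (coordProb x) := by
  unfold coordProb
  fun_prop

theorem sum_coordProb {d : ℕ} (ψ : unitSphere d) : ∑ x, coordProb x ψ = 1 := by
  have h : ‖(ψ : EuclideanSpace ℂ (Fin d))‖ = 1 := by simp
  simp only [coordProb, ← EuclideanSpace.norm_sq_eq, h, one_pow]

/-- The reflection of `ℂ^d` in the line spanned by `e_x + c e_y`. -/
def planeReflection {d : ℕ} (x y : Fin d) (c : ℂ) :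
    EuclideanSpace ℂ (Fin d) ≃ₗᵢ[ℂ] EuclideanSpace ℂ (Fin d) :=
  (Submodule.span ℂ {EuclideanSpace.single x (1 : ℂ) + EuclideanSpace.single y c}).reflection

theorem planeReflection_apply {d : ℕ} {x y : Fin d} (hxy : x ≠ y) (c : ℂ)
    (v : EuclideanSpace ℂ (Fin d)) (z : Fin d) :
    planeReflection x y c v z =
      2 * ((v x + star c * v y) / (1 + (‖c‖ : ℂ) ^ 2)) *
        ((if z = x then 1 else 0) + (if z = y then c else 0)) - v z := by
  have hn : ‖EuclideanSpace.single x (1 : ℂ) + EuclideanSpace.single y c‖ ^ 2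
      = 1 + ‖c‖ ^ 2 := by
    rw [sq, norm_add_sq_eq_norm_sq_add_norm_sq_of_inner_eq_zero (𝕜 := ℂ)]
    · simp [sq]
    · simp [EuclideanSpace.inner_single_left, hxy]
  rw [planeReflection, Submodule.reflection_singleton_apply]
  norm_cast
  rw [hn]
  simp [inner_add_left, EuclideanSpace.inner_single_left]
  split_ifs <;> ring

/-- The reflection with `c = 1` exchanges the two coordinates. -/
theorem coordProb_swap {d : ℕ} {x y : Fin d} (hxy : x ≠ y) (ψ : unitSphere d) :
    coordProb x (sphereMap d (planeReflection x y 1) ψ) = coordProb y ψ ∧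
      coordProb y (sphereMap d (planeReflection x y 1) ψ) = coordProb x ψ := by
  simp only [coordProb, sphereMap, planeReflection_apply hxy]
  constructor <;> congr 2 <;> simp [hxy, hxy.symm] <;> ring

theorem coordProb_planeReflection {d : ℕ} {x y : Fin d} (hxy : x ≠ y) {c : ℂ} (hc : ‖c‖ = 2)
    (ψ : unitSphere d) :
    coordProb x (sphereMap d (planeReflection x y c) ψ) =
      (9 * coordProb x ψ + 16 * coordProb y ψ
        - 12 * (star c * ψ.1 y * star (ψ.1 x)).re) / 25 := by
  simp only [coordProb, sphereMap, planeReflection_apply hxy, hc]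
  have hc' : c.re ^ 2 + c.im ^ 2 = 4 := by
    have := Complex.sq_norm c
    rw [hc, Complex.normSq_apply] at this
    linarith
  have e : 2 * ((ψ.1 x + star c * ψ.1 y) / (1 + ((2 : ℝ) : ℂ) ^ 2)) *
      ((if True then 1 else 0) + (if x = y then c else 0)) - ψ.1 x
      = (2 * (star c * ψ.1 y) - 3 * ψ.1 x) / 5 := by
    simp [hxy]
    ring
  rw [e, norm_div, div_pow]
  simp only [Complex.sq_norm, Complex.normSq_apply]
  simp
  linear_combination (4 / 25 * ((ψ.1 y).re ^ 2 + (ψ.1 y).im ^ 2)) * hc'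

/-- Second and third powers of the weight of `x`, summed over the reflections with
`c ∈ {2, -2, 2i, -2i}`. -/
theorem sum_coordProb_planeReflection {d : ℕ} {x y : Fin d} (hxy : x ≠ y) (ψ : unitSphere d) :
    let r (c : ℂ) := coordProb x (sphereMap d (planeReflection x y c) ψ)
    let u := coordProb x ψ
    let v := coordProb y ψ
    r 2 ^ 2 + r (-2) ^ 2 + r (2 * Complex.I) ^ 2 + r (-(2 * Complex.I)) ^ 2 =
        4 / 625 * (81 * u ^ 2 + 256 * v ^ 2 + 576 * (u * v)) ∧
      r 2 ^ 3 + r (-2) ^ 3 + r (2 * Complex.I) ^ 3 + r (-(2 * Complex.I)) ^ 3 =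
        4 / 15625 * (729 * u ^ 3 + 4096 * v ^ 3 + 11664 * (u ^ 2 * v)
          + 20736 * (v ^ 2 * u)) := by
  intro r u v
  have h1 := coordProb_planeReflection hxy (c := 2) (by simp) ψ
  have h2 := coordProb_planeReflection hxy (c := -2) (by simp) ψ
  have h3 := coordProb_planeReflection hxy (c := 2 * Complex.I) (by simp) ψ
  have h4 := coordProb_planeReflection hxy (c := -(2 * Complex.I)) (by simp) ψ
  simp only [r, u, v, h1, h2, h3, h4]
  simp only [coordProb, Complex.sq_norm, Complex.normSq_apply]
  simp
  constructor <;> ring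

theorem integral_coordProb_pow_swap {d : ℕ} {σ : Measure (unitSphere d)}
    (hσ : IsUniformSphereMeasure d σ) {x y : Fin d} (hxy : x ≠ y) (k l : ℕ) :
    ∫ ψ, coordProb y ψ ^ k * coordProb x ψ ^ l ∂σ =
      ∫ ψ, coordProb x ψ ^ k * coordProb y ψ ^ l ∂σ := by
  rw [← hσ.integral_sphereMap (planeReflection x y 1)
    (f := fun ψ => coordProb x ψ ^ k * coordProb y ψ ^ l) (by fun_prop)]
  simp only [coordProb_swap hxy]

theorem integral_sum_coordProb_planeReflection {d : ℕ} {σ : Measure (unitSphere d)}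
    (hσ : IsUniformSphereMeasure d σ) (x y : Fin d) (k : ℕ) :
    ∫ ψ, (coordProb x (sphereMap d (planeReflection x y 2) ψ) ^ k
      + coordProb x (sphereMap d (planeReflection x y (-2)) ψ) ^ k
      + coordProb x (sphereMap d (planeReflection x y (2 * Complex.I)) ψ) ^ k
      + coordProb x (sphereMap d (planeReflection x y (-(2 * Complex.I))) ψ) ^ k) ∂σ
      = 4 * ∫ ψ, coordProb x ψ ^ k ∂σ := by
  have hf : Continuous fun ψ : unitSphere d => coordProb x ψ ^ k := by fun_prop
  have he (c : ℂ) := hσ.integral_sphereMap (planeReflection x y c) hf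
  rw [integral_add (hσ.integrable (by fun_prop)) (hσ.integrable (by fun_prop)),
    integral_add (hσ.integrable (by fun_prop)) (hσ.integrable (by fun_prop)),
    integral_add (hσ.integrable (by fun_prop)) (hσ.integrable (by fun_prop)), he, he, he, he]
  ring

theorem integral_coordProb_sq {d : ℕ} {σ : Measure (unitSphere d)}
    (hσ : IsUniformSphereMeasure d σ) {x y : Fin d} (hxy : x ≠ y) :
    ∫ ψ, coordProb x ψ ^ 2 ∂σ = 2 * ∫ ψ, coordProb x ψ * coordProb y ψ ∂σ := by
  have h := integral_sum_coordProb_planeReflection hσ x y 2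
  simp only [(sum_coordProb_planeReflection hxy _).1] at h
  rw [integral_const_mul, integral_add (hσ.integrable (by fun_prop)) (hσ.integrable (by fun_prop)),
    integral_add (hσ.integrable (by fun_prop)) (hσ.integrable (by fun_prop))] at h
  simp only [integral_const_mul] at h
  have hs := integral_coordProb_pow_swap hσ hxy 2 0
  simp only [pow_zero, mul_one] at hs
  linarith

theorem integral_coordProb_cube {d : ℕ} {σ : Measure (unitSphere d)}
    (hσ : IsUniformSphereMeasure d σ) {x y : Fin d} (hxy : x ≠ y) :
    ∫ ψ, coordProb x ψ ^ 3 ∂σ = 3 * ∫ ψ, coordProb x ψ ^ 2 * coordProb y ψ ∂σ := by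
  have h := integral_sum_coordProb_planeReflection hσ x y 3
  simp only [(sum_coordProb_planeReflection hxy _).2] at h
  rw [integral_const_mul, integral_add (hσ.integrable (by fun_prop)) (hσ.integrable (by fun_prop)),
    integral_add (hσ.integrable (by fun_prop)) (hσ.integrable (by fun_prop)),
    integral_add (hσ.integrable (by fun_prop)) (hσ.integrable (by fun_prop))] at h
  simp only [integral_const_mul] at h
  have hs := integral_coordProb_pow_swap hσ hxy 3 0
  have ht := integral_coordProb_pow_swap hσ hxy 2 1
  simp only [pow_zero, mul_one, pow_one] at hs ht
  linarith

theorem integral_eq_sum_mul_coordProb {d : ℕ} {σ : Measure (unitSphere d)}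
    (hσ : IsUniformSphereMeasure d σ) {f : unitSphere d → ℝ} (hf : Continuous f) (x : Fin d) :
    ∫ ψ, f ψ ∂σ = ∫ ψ, f ψ * coordProb x ψ ∂σ +
      ∑ y ∈ Finset.univ.erase x, ∫ ψ, f ψ * coordProb y ψ ∂σ := by
  rw [Finset.add_sum_erase _ (fun y => ∫ ψ, f ψ * coordProb y ψ ∂σ) (Finset.mem_univ x),
    ← integral_finsetSum _ fun y _ => hσ.integrable (by fun_prop)]
  simp only [← Finset.mul_sum, sum_coordProb, mul_one]

/-- The third moment of the weight of a coordinate under the uniform measure. -/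
theorem integral_coordProb_cube_eq {d : ℕ} {σ : Measure (unitSphere d)}
    (hσ : IsUniformSphereMeasure d σ) (x : Fin d) :
    ∫ ψ, coordProb x ψ ^ 3 ∂σ = 6 / (d * (d + 1) * (d + 2)) := by
  have := hσ.1
  have hd : 1 ≤ d := x.pos
  have card : ((Finset.univ.erase x).card : ℝ) = d - 1 := by
    simp [Finset.card_erase_of_mem, Nat.cast_sub hd]
  have sum_const_of {g : Fin d → ℝ} {a : ℝ} (h : ∀ y, x ≠ y → g y = a) :
      ∑ y ∈ Finset.univ.erase x, g y = (d - 1) * a := by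
    rw [Finset.sum_congr rfl fun y hy => h y (Finset.ne_of_mem_erase hy).symm,
      Finset.sum_const, nsmul_eq_mul, card]
  have m1 := integral_eq_sum_mul_coordProb hσ (f := fun _ => 1) continuous_const x
  have m2 := integral_eq_sum_mul_coordProb hσ (f := coordProb x) (by fun_prop) x
  have m3 := integral_eq_sum_mul_coordProb hσ (f := fun ψ => coordProb x ψ ^ 2) (by fun_prop) x
  rw [sum_const_of (a := ∫ ψ, coordProb x ψ ∂σ) fun y hy => by
    simpa using integral_coordProb_pow_swap hσ hy 1 0] at m1
  rw [sum_const_of (a := (∫ ψ, coordProb x ψ ^ 2 ∂σ) / 2) fun y hy => by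
    rw [integral_coordProb_sq hσ hy]; ring] at m2
  rw [sum_const_of (a := (∫ ψ, coordProb x ψ ^ 3 ∂σ) / 3) fun y hy => by
    rw [integral_coordProb_cube hσ hy]; ring] at m3
  simp only [one_mul, integral_const, probReal_univ, smul_eq_mul, ← pow_two, ← pow_succ] at m1 m2 m3
  norm_num at m3
  rw [eq_div_iff (by positivity)]
  linear_combination (-6) * m1 - 6 * d * m2 - 3 * d * (d + 1) * m3

theorem qColl_eq {d : ℕ} (ψ : unitSphere d) : qColl d ψ = ∑ x, coordProb x ψ ^ 3 := by
  simp only [qColl, coordProb, ← pow_mul]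

/-- The mean three-way collision probability of a uniformly random state. -/
theorem integral_qColl {d : ℕ} (hd : 1 ≤ d) {σ : Measure (unitSphere d)}
    (hσ : IsUniformSphereMeasure d σ) :
    ∫ ψ, qColl d ψ ∂σ = 6 / ((d + 1) * (d + 2)) := by
  have hd' : (d : ℝ) ≠ 0 := by positivity
  simp only [qColl_eq]
  rw [integral_finsetSum _ fun y _ => hσ.integrable (by fun_prop)]
  simp only [integral_coordProb_cube_eq hσ, Finset.sum_const, Finset.card_univ, Fintype.card_fin,
    nsmul_eq_mul]
  field_simp

/-- Tail bound for the three-way collision probability: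
`σ(q_ψ ≥ d^(-3/2)) ≤ 6/√d`. -/
theorem qColl_tail (d : ℕ) (hd : 1 ≤ d) (σ : Measure (unitSphere d))
    (hσ : IsUniformSphereMeasure d σ) :
    σ {ψ : unitSphere d | (d : ℝ) ^ (-(3 : ℝ) / 2) ≤ qColl d ψ}
      ≤ ENNReal.ofReal (6 / Real.sqrt d) := by
  have := hσ.1
  have hd0 : (0 : ℝ) < d := by exact_mod_cast hd
  have hc : Continuous (qColl d) := by
    simp only [funext qColl_eq]
    fun_prop
  have markov := mul_meas_ge_le_integral_of_nonneg (μ := σ) (f := qColl d)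
    (ae_of_all _ fun ψ => Finset.sum_nonneg fun x _ => by positivity) (hσ.integrable hc)
    ((d : ℝ) ^ (-(3 : ℝ) / 2))
  rw [integral_qColl hd hσ] at markov
  rw [← ENNReal.ofReal_toReal (measure_ne_top σ _)]
  apply ENNReal.ofReal_le_ofReal
  have hs : (0 : ℝ) < Real.sqrt d := Real.sqrt_pos.2 hd0
  have hp : (d : ℝ) ^ (-(3 : ℝ) / 2) = 1 / (d * Real.sqrt d) := by
    rw [neg_div, Real.rpow_neg hd0.le, show (3 : ℝ) / 2 = 1 + 1 / 2 by norm_num,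
      Real.rpow_add hd0, Real.rpow_one, ← Real.sqrt_eq_rpow, one_div]
  have hb : (6 : ℝ) / ((d + 1) * (d + 2)) ≤ 6 / d ^ 2 := by
    gcongr
    nlinarith
  have hpos : 0 < (d : ℝ) ^ (-(3 : ℝ) / 2) := by positivity
  refine le_of_mul_le_mul_left ((markov.trans hb).trans_eq ?_) hpos
  rw [hp]
  have := Real.sq_sqrt hd0.le
  field_simp
  linarith
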